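/- Let q be a positive integer and let 𝔠 be an ample q-zigzagged constellation. Then there is no induced subgraph H of 𝔠 isomorphic to a proper subdivision of the star K_{1,2q+1} such that the center and all the leaves of H have degree at least 4 in 𝔠. -/

import Mathlib

open SimpleGraph

/-- Two vertex sets `X` and `Y` are *anticomplete* in `G` if they are disjoint and
there is no edge of `G` with an end in each. -/
def Anticomplete {V : Type} (G : SimpleGraph V) (X Y : Set V) : Prop :=
  Disjoint X Y ∧ ∀ x ∈ X, ∀ y ∈ Y, ¬ G.Adj x y

/-- `G` has an induced subgraph isomorphic to `H`. -/
def HasInducedSubgraphIso {V W : Type} (G : SimpleGraph V) (H : SimpleGraph W) : Prop :=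
  ∃ X : Set V, Nonempty (H ≃g G.induce X)

/-- `G` has an induced minor isomorphic to `H`, witnessed by branch sets. -/
def HasInducedMinor {V W : Type} (G : SimpleGraph V) (H : SimpleGraph W) : Prop :=
  ∃ B : W → Set V,
    (∀ w, (G.induce (B w)).Connected) ∧
    (Pairwise fun u v => Disjoint (B u) (B v)) ∧
    (∀ u v : W, u ≠ v → (H.Adj u v ↔ ¬ Anticomplete G (B u) (B v)))

/-- The set `P` induces a path in `G`. -/
def IsPathSet {V : Type} (G : SimpleGraph V) (P : Set V) : Prop :=
  ∃ n : ℕ, Nonempty (G.induce P ≃g pathGraph (n + 1))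

/-- The vertex sets of the connected components of the subgraph of `G` induced on `X`. -/
def CompsOn {V : Type} (G : SimpleGraph V) (X : Set V) : Set (Set V) :=
  {L | ∃ C : (G.induce X).ConnectedComponent, L = Subtype.val '' C.supp}

/-- The induced subgraph of `G` on `W` together with the stable set `S ⊆ W` forms a
constellation: every component of `W \ S` is a path and every vertex of `S` has a
neighbor in every such component. -/
structure IsConstellationOn {V : Type} (G : SimpleGraph V) (W S : Set V) : Prop where
  subset : S ⊆ W
  stable : ∀ x ∈ S, ∀ y ∈ S, ¬ G.Adj x y
  comp_paths : ∀ L ∈ CompsOn G (W \ S), IsPathSet G L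
  dominates : ∀ x ∈ S, ∀ L ∈ CompsOn G (W \ S), ∃ y ∈ L, G.Adj x y

/-- `p` is a route of the constellation `(W, S)` in `G`: an induced path of the induced
subgraph of `G` on `W`, with its two (distinct) ends in `S` and its interior outside `S`. -/
structure IsRoute {V : Type} (G : SimpleGraph V) (W S : Set V) {x y : V}
    (p : G.Walk x y) : Prop where
  ne : x ≠ y
  isPath : p.IsPath
  induced : ∀ u v, u ∈ p.support → v ∈ p.support → G.Adj u v → p.toSubgraph.Adj u v
  support_mem : ∀ v ∈ p.support, v ∈ W
  fst_mem : x ∈ S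
  snd_mem : y ∈ S
  interior : ∀ v ∈ p.support, v ≠ x → v ≠ y → v ∉ S

/-- The constellation `(W, S)` in `G` is `d`-ample: no route has length at most `d+1`. -/
def DAmple {V : Type} (G : SimpleGraph V) (W S : Set V) (d : ℕ) : Prop :=
  ∀ ⦃x y : V⦄ (p : G.Walk x y), IsRoute G W S p → d + 1 < p.length

/-- The constellation `(W, S)` in `G` is interrupted with respect to some linear order
(encoded by an injective-on-`S` function `f : V → ℕ`). -/
def Interrupted {V : Type} (G : SimpleGraph V) (W S : Set V) : Prop :=
  ∃ f : V → ℕ, Set.InjOn f S ∧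
    ∀ x ∈ S, ∀ y ∈ S, ∀ z ∈ S, f x < f y → f y < f z →
      ∀ (p : G.Walk x y), IsRoute G W S p → ∃ v ∈ p.support, G.Adj z v

/-- The constellation `(W, S)` in `G` is `q`-zigzagged. -/
def Zigzagged {V : Type} (G : SimpleGraph V) (W S : Set V) (q : ℕ) : Prop :=
  ∃ f : V → ℕ, Set.InjOn f S ∧
    ∀ x ∈ S, ∀ y ∈ S, f x < f y →
      ∀ (p : G.Walk x y), IsRoute G W S p →
        {z | z ∈ S ∧ f x < f z ∧ f z < f y ∧ ¬ ∃ v ∈ p.support, G.Adj z v}.ncard < q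

/-- The constellation `(W, S)` in `G` is `(qm, q, qp)`-mixed. -/
def Mixed {V : Type} (G : SimpleGraph V) (W S : Set V) (qm q qp : ℕ) : Prop :=
  ∃ f : V → ℕ, Set.InjOn f S ∧
    ∀ x ∈ S, ∀ y ∈ S, f x < f y →
      ∀ (p : G.Walk x y), IsRoute G W S p →
        ∀ Qm Q Qp : Set V, Qm ⊆ S → Q ⊆ S → Qp ⊆ S →
          Qm.ncard = qm → Q.ncard = q → Qp.ncard = qp →
          (∀ z ∈ Qm, f z < f x) → (∀ z ∈ Q, f x < f z ∧ f z < f y) →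
          (∀ z ∈ Qp, f y < f z) →
          ∃ z ∈ Qm ∪ Q ∪ Qp, ∃ v ∈ p.support, G.Adj z v

/-- The constellation `(W', S')` sits in the constellation `(W, S)` (both within `G`). -/
def SitsIn {V : Type} (G : SimpleGraph V) (W' S' W S : Set V) : Prop :=
  W' ⊆ W ∧ S' ⊆ S ∧
  (∀ L ∈ CompsOn G (W' \ S'), ∃ M ∈ CompsOn G (W \ S), L ⊆ M) ∧
  (∀ M ∈ CompsOn G (W \ S), ∀ L₁ ∈ CompsOn G (W' \ S'), ∀ L₂ ∈ CompsOn G (W' \ S'),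
      L₁ ⊆ M → L₂ ⊆ M → L₁ = L₂)

/-- A witness that `S` is a subdivision of `H`, where each edge of `H` is replaced by a
path whose length satisfies `ok`. -/
structure SubdivModel {U W : Type} (S : SimpleGraph U) (H : SimpleGraph W)
    (ok : ℕ → Prop) where
  b : W → U
  b_inj : Function.Injective b
  path : ∀ ⦃u v : W⦄, H.Adj u v → S.Walk (b u) (b v)
  path_isPath : ∀ ⦃u v : W⦄ (h : H.Adj u v), (path h).IsPath
  path_len : ∀ ⦃u v : W⦄ (h : H.Adj u v), ok (path h).length
  path_symm : ∀ ⦃u v : W⦄ (h : H.Adj u v), path h.symm = (path h).reverse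
  branch_avoid : ∀ ⦃u v : W⦄ (h : H.Adj u v) (w : W), b w ∈ (path h).support → w = u ∨ w = v
  interiors_anticomplete :
    ∀ ⦃u v u' v' : W⦄ (h : H.Adj u v) (h' : H.Adj u' v'),
      (s(u, v) : Sym2 W) ≠ s(u', v') →
      ∀ x ∈ (path h).support, x ≠ b u → x ≠ b v →
      ∀ y ∈ (path h').support, y ≠ b u' → y ≠ b v' →
        x ≠ y ∧ ¬ S.Adj x y
  cover : ∀ x : U, (∃ w, x = b w) ∨ ∃ (u v : W) (h : H.Adj u v), x ∈ (path h).support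
  edges_eq : ∀ x y : U, S.Adj x y → ∃ (u v : W) (h : H.Adj u v), (path h).toSubgraph.Adj x y

/-- `S` is a subdivision of `H` with path lengths satisfying `ok`. -/
def IsSubdivisionWith {U W : Type} (S : SimpleGraph U) (H : SimpleGraph W)
    (ok : ℕ → Prop) : Prop :=
  Nonempty (SubdivModel S H ok)

/-- The line graph of `G`. -/
def LineGraph {V : Type} (G : SimpleGraph V) : SimpleGraph G.edgeSet :=
  SimpleGraph.fromRel (fun e f => ∃ v : V, v ∈ (e : Sym2 V) ∧ v ∈ (f : Sym2 V))

/-- The `r`-by-`r` hexagonal wall (brick wall). -/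
def Wall (r : ℕ) : SimpleGraph (Fin r × Fin (2 * r)) :=
  SimpleGraph.fromRel (fun a b =>
    (a.1 = b.1 ∧ a.2.val + 1 = b.2.val) ∨
    (a.2 = b.2 ∧ a.1.val + 1 = b.1.val ∧ (a.1.val + a.2.val) % 2 = 0))

/-- The full binary tree of radius `r`, on `2^(r+1) - 1` vertices (heap indexing). -/
def BinTree (r : ℕ) : SimpleGraph (Fin (2 ^ (r + 1) - 1)) :=
  SimpleGraph.fromRel (fun a b =>
    b.val + 1 = 2 * (a.val + 1) ∨ b.val + 1 = 2 * (a.val + 1) + 1)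

/-- The leaf-extension of `H` by leaves `L` attached via `f`. -/
def leafExt {W : Type} (H : SimpleGraph W) (L : Type) (f : L → W) :
    SimpleGraph (W ⊕ L) :=
  SimpleGraph.fromRel (fun a b =>
    match a, b with
    | Sum.inl a, Sum.inl b => H.Adj a b
    | Sum.inl a, Sum.inr x => f x = a
    | _, _ => False)

/-- `G` has treewidth at most `k` (via tree decompositions). -/
def TreewidthLE {V : Type} (G : SimpleGraph V) (k : ℕ) : Prop :=
  ∃ (ι : Type) (T : SimpleGraph ι) (bag : ι → Set V),
    T.IsTree ∧
    (∀ v, ∃ i, v ∈ bag i) ∧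
    (∀ u v, G.Adj u v → ∃ i, u ∈ bag i ∧ v ∈ bag i) ∧
    (∀ v, (T.induce {i | v ∈ bag i}).Connected) ∧
    (∀ i, (bag i).ncard ≤ k + 1)

/-- `G` has pathwidth at most `k` (via path decompositions). -/
def PathwidthLE {V : Type} (G : SimpleGraph V) (k : ℕ) : Prop :=
  ∃ (n : ℕ) (bag : Fin n → Set V),
    (∀ v, ∃ i, v ∈ bag i) ∧
    (∀ u v, G.Adj u v → ∃ i, u ∈ bag i ∧ v ∈ bag i) ∧
    (∀ (v : V) (i j k' : Fin n), i ≤ j → j ≤ k' → v ∈ bag i → v ∈ bag k' → v ∈ bag j) ∧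
    (∀ i, (bag i).ncard ≤ k + 1)

/-- An induced `(s,t)`-model in `G`. -/
def IsInducedModel {V : Type} (G : SimpleGraph V) {s t : ℕ}
    (A : Fin s → Set V) (B : Fin t → Set V) : Prop :=
  (∀ i, (G.induce (A i)).Connected) ∧
  (∀ j, (G.induce (B j)).Connected) ∧
  (∀ i j : Fin s, i ≠ j → Anticomplete G (A i) (A j)) ∧
  (∀ i j : Fin t, i ≠ j → Anticomplete G (B i) (B j)) ∧
  (∀ (i : Fin s) (j : Fin t), Disjoint (A i) (B j) ∧ ¬ Anticomplete G (A i) (B j))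

/-- The `A`-contraction of a model: each `A i` is contracted to the vertex `Sum.inl i`. -/
def AContraction {V : Type} (G : SimpleGraph V) {s t : ℕ}
    (A : Fin s → Set V) (B : Fin t → Set V) :
    SimpleGraph (Fin s ⊕ (⋃ j, B j : Set V)) :=
  SimpleGraph.fromRel (fun x y =>
    match x, y with
    | Sum.inl i, Sum.inl i' => i ≠ i' ∧ ∃ a ∈ A i, ∃ a' ∈ A i', G.Adj a a'
    | Sum.inl i, Sum.inr b => ∃ a ∈ A i, G.Adj a ↑b
    | Sum.inr b, Sum.inr b' => G.Adj ↑b ↑b'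
    | _, _ => False)

/-- A linear induced model is `d`-`A`-ample if its `A`-contraction is `d`-ample. -/
def ModelAAmple {V : Type} (G : SimpleGraph V) {s t : ℕ}
    (A : Fin s → Set V) (B : Fin t → Set V) (d : ℕ) : Prop :=
  DAmple (AContraction G A B) Set.univ (Set.range Sum.inl) d

/-- A linear induced model is `d`-ample if it is `d`-`A`-ample and `d`-`B`-ample. -/
def ModelAmple {V : Type} (G : SimpleGraph V) {s t : ℕ}
    (A : Fin s → Set V) (B : Fin t → Set V) (d : ℕ) : Prop :=
  ModelAAmple G A B d ∧ ModelAAmple G B A d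

/-- The zigzag sequences. -/
def Zseq : ℕ → List ℤ
  | 0 => []
  | 1 => [1]
  | 2 => [1, 2]
  | 3 => [1, 2, 3]
  | n + 4 =>
      (Zseq (n + 3)).dropLast ++ (((Zseq (n + 2)).map (· + 1)).reverse).dropLast
        ++ (Zseq (n + 3)).map (· + 1)

/-- Collapse each maximal run of consecutive equal entries to a single entry. -/
def collapse (l : List ℤ) : List ℤ := l.destutter (· ≠ ·)

/-- `B` is an alignment in the sequence `A`. -/
def IsAlignment (A : List ℤ) (B : Finset ℤ) : Prop :=
  (∀ b ∈ B, b ∈ A) ∧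
  ∃ i j : ℕ, i ≤ j ∧ j < A.length ∧
    ∀ b ∈ B,
      (collapse (((A.take (j + 1)).drop i).filter (fun a => decide (a ∈ B)))).count b = 1

/-- Reversing a route gives a route. -/
theorem IsRoute.reverse {V : Type} {G : SimpleGraph V} {W S : Set V} {x y : V}
    {p : G.Walk x y} (h : IsRoute G W S p) : IsRoute G W S p.reverse where
  ne := h.ne.symm
  isPath := h.isPath.reverse
  induced u v hu hv huv := by
    rw [Walk.toSubgraph_reverse]
    exact h.induced u v (by simpa using hu) (by simpa using hv) huv
  support_mem v hv := h.support_mem v (by simpa using hv)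
  fst_mem := h.snd_mem
  snd_mem := h.fst_mem
  interior v hv hy hx := h.interior v (by simpa using hv) hx hy

/-- In an ample constellation, a vertex outside `S` has at most one neighbor in `S`. -/
theorem DAmple.eq_of_adj {V : Type} {G : SimpleGraph V} {S : Set V}
    (hc : IsConstellationOn G Set.univ S) (ha : DAmple G Set.univ S 1)
    {v x y : V} (hv : v ∉ S) (hx : x ∈ S) (hy : y ∈ S) (hvx : G.Adj v x) (hvy : G.Adj v y) :
    x = y := by
  by_contra hxy
  have := ha (Walk.cons hvx.symm (Walk.cons hvy Walk.nil)) {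
    ne := hxy
    isPath := by
      have h1 := hvx.ne
      have h2 := hvy.ne
      simp [Walk.cons_isPath_iff, hxy, h1.symm, h2]
    induced := by
      intro a b h1 h2 hab
      have h3 := hc.stable x hx y hy
      have h4 := hc.stable y hy x hx
      simp only [Walk.support_cons, Walk.support_nil, List.mem_cons, List.not_mem_nil,
        or_false] at h1 h2
      rcases h1 with rfl | rfl | rfl <;> rcases h2 with rfl | rfl | rfl <;>
        simp_all
    support_mem := fun _ _ => Set.mem_univ _
    fst_mem := hx
    snd_mem := hy
    interior := by
      intro a h1 h2 h3
      simp only [Walk.support_cons, Walk.support_nil, List.mem_cons, List.not_mem_nil,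
        or_false] at h1
      rcases h1 with rfl | rfl | rfl <;> simp_all }
  simp at this

/-- In a constellation, a vertex outside `S` has at most two neighbors outside `S`. -/
theorem IsConstellationOn.ncard_neighborSet_diff_le {V : Type} [Finite V] {G : SimpleGraph V}
    {S : Set V} (hc : IsConstellationOn G Set.univ S) {v : V} (hv : v ∉ S) :
    (G.neighborSet v \ S).ncard ≤ 2 := by
  classical
  have hv' : v ∈ Set.univ \ S := ⟨trivial, hv⟩
  set C := (G.induce (Set.univ \ S)).connectedComponentMk ⟨v, hv'⟩ with hC
  obtain ⟨n, ⟨e⟩⟩ := hc.comp_paths (Subtype.val '' C.supp) ⟨C, rfl⟩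
  have hvL : v ∈ Subtype.val '' C.supp := ⟨⟨v, hv'⟩, rfl, rfl⟩
  have hL : ∀ w ∈ G.neighborSet v \ S, w ∈ Subtype.val '' C.supp := by
    rintro w ⟨hw, hwS⟩
    refine ⟨⟨w, trivial, hwS⟩, ?_, rfl⟩
    rw [ConnectedComponent.mem_supp_iff, hC, ConnectedComponent.eq]
    exact Adj.reachable (show G.Adj w v from hw.symm)
  let g : V → ℕ := fun w => if h : w ∈ Subtype.val '' C.supp then (e ⟨w, h⟩ : ℕ) else 0
  have key : (G.neighborSet v \ S).ncard ≤ ({g v - 1, g v + 1} : Set ℕ).ncard := by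
    refine Set.ncard_le_ncard_of_injOn g ?_ ?_
    · intro w hw
      have hadj : (pathGraph (n + 1)).Adj (e ⟨v, hvL⟩) (e ⟨w, hL w hw⟩) :=
        e.map_adj_iff.2 (show G.Adj v w from hw.1)
      rw [pathGraph_adj] at hadj
      simp only [g, dif_pos hvL, dif_pos (hL w hw), Set.mem_insert_iff, Set.mem_singleton_iff]
      omega
    · intro a haa b hbb hab
      simp only [g, dif_pos (hL a haa), dif_pos (hL b hbb)] at hab
      simpa using e.injective (Fin.ext hab)
  exact key.trans ((Set.ncard_insert_le _ _).trans (by simp))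

/-- In an ample constellation, every vertex of degree at least `4` belongs to `S`. -/
theorem DAmple.mem_of_four_le {V : Type} [Finite V] {G : SimpleGraph V} {S : Set V}
    (hc : IsConstellationOn G Set.univ S) (ha : DAmple G Set.univ S 1)
    {v : V} (hv : 4 ≤ (G.neighborSet v).ncard) : v ∈ S := by
  by_contra hvS
  have h1 := hc.ncard_neighborSet_diff_le hvS
  have h2 : (G.neighborSet v ∩ S).ncard ≤ 1 :=
    (Set.ncard_le_one (Set.toFinite _)).2 fun x hx y hy =>
      DAmple.eq_of_adj hc ha hvS hx.2 hy.2 hx.1 hy.1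
  have h3 := Set.ncard_inter_add_ncard_sdiff_eq_ncard (G.neighborSet v) S (Set.toFinite _)
  omega

/-- A walk between two vertices of `S` contains a route from its first vertex to some
vertex of `S`. -/
theorem exists_isRoute_of_walk {V : Type} {G : SimpleGraph V} {S : Set V} {x y : V}
    (hx : x ∈ S) (hy : y ∈ S) (hxy : x ≠ y) (p : G.Walk x y) :
    ∃ (z : V) (r : G.Walk x z), IsRoute G Set.univ S r ∧ r.support ⊆ p.support := by
  classical
  let P : ℕ → Prop := fun n => ∃ (z : V) (r : G.Walk x z),
    z ∈ S ∧ x ≠ z ∧ r.support ⊆ p.support ∧ r.length = n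
  have hP : ∃ n, P n := ⟨_, y, p, hy, hxy, fun _ h => h, rfl⟩
  obtain ⟨z, r₀, hz, hxz, hr₀, hlen₀⟩ := Nat.find_spec hP
  have hmin : ∀ (z : V) (r : G.Walk x z), z ∈ S → x ≠ z → r.support ⊆ p.support →
      r₀.length ≤ r.length := fun z r h1 h2 h3 =>
    hlen₀.trans_le (Nat.find_min' hP ⟨z, r, h1, h2, h3, rfl⟩)
  obtain ⟨r, hpath, hr, hmin⟩ : ∃ r : G.Walk x z, r.IsPath ∧ r.support ⊆ p.support ∧
      ∀ (z : V) (r' : G.Walk x z), z ∈ S → x ≠ z → r'.support ⊆ p.support →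
        r.length ≤ r'.length :=
    ⟨r₀.bypass, r₀.bypass_isPath, fun a h => hr₀ (r₀.support_bypass_subset_support h),
      fun z r' h1 h2 h3 => r₀.length_bypass_le_length.trans (hmin z r' h1 h2 h3)⟩
  have hchord : ∀ i j, i < j → j ≤ r.length → G.Adj (r.getVert i) (r.getVert j) →
      j = i + 1 := by
    intro i j hij hj hadj
    by_contra hne
    have := hmin z ((r.take i).append (Walk.cons hadj (r.drop j))) hz hxz (by
      intro a h
      rw [Walk.mem_support_append_iff, Walk.support_cons, List.mem_cons] at h
      rcases h with h | rfl | h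
      · exact hr ((r.isSubwalk_take i).support_subset h)
      · exact hr (r.getVert_mem_support i)
      · exact hr ((r.isSubwalk_drop j).support_subset h))
    simp only [Walk.length_append, Walk.length_cons, Walk.take_length, Walk.drop_length] at this
    omega
  refine ⟨z, r, ⟨hxz, hpath, ?_, fun _ _ => trivial, hx, hz, ?_⟩, hr⟩
  · intro u v hu hv huv
    obtain ⟨i, rfl, hi⟩ := Walk.mem_support_iff_exists_getVert.1 hu
    obtain ⟨j, rfl, hj⟩ := Walk.mem_support_iff_exists_getVert.1 hv
    rcases lt_trichotomy i j with h | rfl | h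
    · obtain rfl := hchord i j h hj huv
      exact r.toSubgraph_adj_getVert (by omega)
    · exact absurd rfl huv.ne
    · obtain rfl := hchord j i h hi huv.symm
      exact (r.toSubgraph_adj_getVert (by omega)).symm
  · intro v hv hvx hvz hvS
    have h1 := hmin v (r.takeUntil v hv) hvS hvx.symm
      fun a h => hr (r.support_takeUntil_subset_support hv h)
    have h2 := r.length_takeUntil_lt_length hv hvz
    omega

/-- In a subdivision of a star, distinct arms meet only in the center. -/
theorem SubdivModel.star_ne {U : Type} {S : SimpleGraph U} {n : ℕ} {ok : ℕ → Prop}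
    (m : SubdivModel S (completeBipartiteGraph (Fin 1) (Fin n)) ok)
    (h : ∀ i : Fin n, (completeBipartiteGraph (Fin 1) (Fin n)).Adj (Sum.inl 0) (Sum.inr i))
    {i j : Fin n} (hij : i ≠ j) {a b : U} (ha : a ∈ (m.path (h i)).support)
    (hb : b ∈ (m.path (h j)).support) (hac : a ≠ m.b (Sum.inl 0)) :
    a ≠ b := by
  rintro rfl
  by_cases hai : a = m.b (Sum.inr i)
  · subst hai
    have := m.branch_avoid (h j) _ hb
    simp [hij] at this
  by_cases haj : a = m.b (Sum.inr j)
  · subst haj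
    have := m.branch_avoid (h i) _ ha
    simp [hij.symm] at this
  exact (m.interiors_anticomplete (h i) (h j) (by simp [hij]) a ha hac hai a hb hac haj).1 rfl

/-- In a subdivision of a star, there is no edge between distinct arms off the center. -/
theorem SubdivModel.star_not_adj {U : Type} {S : SimpleGraph U} {n : ℕ} {ok : ℕ → Prop}
    (m : SubdivModel S (completeBipartiteGraph (Fin 1) (Fin n)) ok)
    (h : ∀ i : Fin n, (completeBipartiteGraph (Fin 1) (Fin n)).Adj (Sum.inl 0) (Sum.inr i))
    {i j : Fin n} (hij : i ≠ j) {a b : U} (ha : a ∈ (m.path (h i)).support)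
    (hb : b ∈ (m.path (h j)).support) (hac : a ≠ m.b (Sum.inl 0))
    (hbc : b ≠ m.b (Sum.inl 0)) : ¬ S.Adj a b := by
  intro hab
  obtain ⟨k, hka, hkb⟩ : ∃ k, a ∈ (m.path (h k)).support ∧ b ∈ (m.path (h k)).support := by
    obtain ⟨u, v, huv, hadj⟩ := m.edges_eq a b hab
    have h1 := (Walk.mem_verts_toSubgraph _).1 hadj.fst_mem
    have h2 := (Walk.mem_verts_toSubgraph _).1 hadj.snd_mem
    rcases u with u | u <;> rcases v with v | v
    · simp at huv
    · obtain rfl := Subsingleton.elim u 0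
      exact ⟨v, h1, h2⟩
    · obtain rfl := Subsingleton.elim v 0
      have := m.path_symm huv
      refine ⟨u, ?_, ?_⟩ <;> rw [show m.path (h u) = _ from this] <;> simpa
    · simp at huv
  by_cases hik : i = k
  · subst hik
    exact m.star_ne h hij hkb hb hbc rfl
  · exact m.star_ne h hik ha hka hac rfl

/-- Lemma 8.5: an ample `q`-zigzagged constellation has no induced
subgraph isomorphic to a proper subdivision of `K_{1,2q+1}` whose center and leaves
have degree at least `4` in `𝔠`. -/
theorem stmt18 {V : Type} [Fintype V] (q : ℕ) (hq : 0 < q)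
    (G : SimpleGraph V) (S : Set V)
    (hc : IsConstellationOn G Set.univ S)
    (ha : DAmple G Set.univ S 1)
    (hz : Zigzagged G Set.univ S q) :
    ¬ ∃ (X : Set V)
        (m : SubdivModel (G.induce X)
          (completeBipartiteGraph (Fin 1) (Fin (2 * q + 1))) (fun n => 2 ≤ n)),
        4 ≤ (G.neighborSet ↑(m.b (Sum.inl 0))).ncard ∧
        ∀ i : Fin (2 * q + 1), 4 ≤ (G.neighborSet ↑(m.b (Sum.inr i))).ncard := by
  classical
  rintro ⟨X, m, hcen, hleaf⟩
  obtain ⟨f, hf, hzz⟩ := hz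
  have h : ∀ i : Fin (2 * q + 1),
      (completeBipartiteGraph (Fin 1) (Fin (2 * q + 1))).Adj (Sum.inl 0) (Sum.inr i) := by simp
  set c : V := ((m.b (Sum.inl 0) : X) : V) with hcdef
  have hcS : c ∈ S := DAmple.mem_of_four_le hc ha hcen
  have hroute : ∀ i, ∃ (z : V) (r : G.Walk c z), IsRoute G Set.univ S r ∧
      ∀ a ∈ r.support, ∃ a' ∈ (m.path (h i)).support, (a' : V) = a := by
    intro i
    obtain ⟨z, r, hr, hsub⟩ := exists_isRoute_of_walk hcS
      (DAmple.mem_of_four_le hc ha (hleaf i))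
      (fun heq => by simpa using m.b_inj (Subtype.ext heq))
      ((m.path (h i)).map (Embedding.induce X).toHom)
    refine ⟨z, r, hr, fun a har => ?_⟩
    have hmap := Walk.support_map (Embedding.induce X).toHom (m.path (h i))
    exact List.mem_map.1 (hmap ▸ hsub har)
  choose s r hr hsub using hroute
  have hne : ∀ i j, i ≠ j → s i ≠ s j := by
    intro i j hij heq
    obtain ⟨a, ha1, ha2⟩ := hsub i _ (r i).end_mem_support
    obtain ⟨b, hb1, hb2⟩ := hsub j _ (r j).end_mem_support
    refine m.star_ne h hij ha1 hb1 (fun hac => (hr i).ne ?_) (Subtype.ext ?_)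
    · rw [← ha2, hac]
    · rw [ha2, hb2, heq]
  have hnadj : ∀ i j, i ≠ j → ∀ v ∈ (r j).support, ¬ G.Adj (s i) v := by
    intro i j hij v hv hadj
    obtain ⟨a, ha1, ha2⟩ := hsub i _ (r i).end_mem_support
    obtain ⟨b, hb1, hb2⟩ := hsub j _ hv
    refine m.star_not_adj h hij ha1 hb1 (fun hac => (hr i).ne ?_) (fun hbc => ?_)
      (show G.Adj a b by rwa [ha2, hb2])
    · rw [← ha2, hac]
    · refine hc.stable _ (hr i).snd_mem c hcS ?_
      rwa [← hb2, hbc] at hadj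
  have hfinj : Function.Injective fun i => f (s i) := fun i j hij => by
    by_contra hij'
    exact hne i j hij' (hf (hr i).snd_mem (hr j).snd_mem hij)
  have hfc : ∀ i, f (s i) ≠ f c := fun i heq =>
    (hr i).ne (hf (hr i).snd_mem hcS heq).symm
  have hcount : ∀ (I : Finset (Fin (2 * q + 1))) (i : Fin (2 * q + 1)) (T : Set V),
      i ∈ I → q + 1 ≤ I.card → (∀ j ∈ I, j ≠ i → s j ∈ T) → ¬ T.ncard < q := by
    intro I i T hi hI hT hlt
    have h1 : ((I.erase i).image s : Finset V).card ≤ T.ncard := by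
      rw [← Set.ncard_coe_finset]
      refine Set.ncard_le_ncard ?_ (Set.toFinite _)
      intro a haI
      obtain ⟨j, hj, rfl⟩ := Finset.mem_image.1 (Finset.mem_coe.1 haI)
      exact hT j (Finset.mem_of_mem_erase hj) (Finset.ne_of_mem_erase hj)
    rw [Finset.card_image_of_injective _ fun i j hij => hfinj (congrArg f hij),
      Finset.card_erase_of_mem hi] at h1
    omega
  have hcard := Finset.card_filter_add_card_filter_not (s := Finset.univ)
    (fun i : Fin (2 * q + 1) => f c < f (s i))
  rw [Finset.card_univ, Fintype.card_fin] at hcard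
  rcases le_or_gt (q + 1) (Finset.univ.filter fun i => f c < f (s i)).card with hI | hI
  · obtain ⟨i, hi, hmax⟩ := Finset.exists_max_image _ (fun i => f (s i))
      (Finset.card_pos.1 (lt_of_lt_of_le q.succ_pos hI))
    refine hcount _ i _ hi hI ?_
      (hzz c hcS (s i) (hr i).snd_mem (Finset.mem_filter.1 hi).2 (r i) (hr i))
    intro j hj hji
    refine ⟨(hr j).snd_mem, (Finset.mem_filter.1 hj).2,
      lt_of_le_of_ne (hmax j hj) (hfinj.ne hji), ?_⟩
    rintro ⟨v, hv, hadj⟩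
    exact hnadj j i hji v hv hadj
  · have hI' : q + 1 ≤ (Finset.univ.filter fun i => ¬ f c < f (s i)).card := by omega
    have hlt : ∀ i ∈ Finset.univ.filter (fun i => ¬ f c < f (s i)), f (s i) < f c := fun i hi =>
      lt_of_le_of_ne (not_lt.1 (Finset.mem_filter.1 hi).2) (hfc i)
    obtain ⟨i, hi, hmin⟩ := Finset.exists_min_image _ (fun i => f (s i))
      (Finset.card_pos.1 (lt_of_lt_of_le q.succ_pos hI'))
    refine hcount _ i _ hi hI' ?_
      (hzz (s i) (hr i).snd_mem c hcS (hlt i hi) (r i).reverse (hr i).reverse)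
    intro j hj hji
    refine ⟨(hr j).snd_mem, lt_of_le_of_ne (hmin j hj) (hfinj.ne hji.symm), hlt j hj, ?_⟩
    rintro ⟨v, hv, hadj⟩
    exact hnadj j i hji v (by simpa using hv) hadj
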